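/- arXiv:1507.01317 — 5 statements merged into one kernel-verified Lean document; each statement's English description precedes it below -/
import Mathlib

section
/- For every nontrivial star T there exist an integer n ≥ 1 and stars T_1, …, T_n such that: T_1 ∈ {T, conj(T)}; for each 2 ≤ i ≤ n, either T_i = d⁺T_{i−1} or T_i = d⁻T_{i−1}; T_i is nontrivial for every 1 ≤ i ≤ n; and T_n is coherent. (In the paper's language: every nontrivial L-type has a sequence of coherence.) -/
/-!
Stars (abstract fat vertices with labels, characters, and dual orientations),
their switch sets, conjugates, and derivatives, following Gordon–Luecke.

A star on `m ≥ 1` labels is modeled with an ambient label space `ZMod m`;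
the actual label set of the star is a `Finset (ZMod m)` (the full star has
label set `Finset.univ`, and derivatives have smaller label sets inheriting
the cyclic order from `ZMod m`).  `omega i` is the dual orientation of the
interval starting at label `i` (i.e. between `i` and the next label),
`+1` meaning source/out and `-1` meaning sink/in.
-/

/-- A star: a label set inside the cyclic set `ZMod m`, a sign, a character
for each label, and a dual orientation for the interval starting at each
label.  (The values of `chi` and `omega` are only meaningful on `labels`.) -/
structure GLStar (m : ℕ) where
  labels : Finset (ZMod m)
  sign : ℤˣ
  chi : ZMod m → ℤˣ
  omega : ZMod m → ℤˣ

namespace GLStar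

variable {m : ℕ}

/-- The cyclic distance (in `1, …, m`) from `i` to the next element of `S`
strictly after `i` (cyclically); `0` if there is none. -/
noncomputable def distTo (S : Finset (ZMod m)) (i : ZMod m) : ℕ :=
  open Classical in
  if h : ∃ k : ℕ, 0 < k ∧ k ≤ m ∧ i + (k : ZMod m) ∈ S then Nat.find h else 0

/-- The first element of `S` strictly after `i`, cyclically. -/
noncomputable def nextIn (S : Finset (ZMod m)) (i : ZMod m) : ZMod m :=
  i + (distTo S i : ZMod m)

/-- The cyclic distance (in `1, …, m`) from the previous element of `S` to `i`. -/
noncomputable def distFrom (S : Finset (ZMod m)) (i : ZMod m) : ℕ :=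
  open Classical in
  if h : ∃ k : ℕ, 0 < k ∧ k ≤ m ∧ i - (k : ZMod m) ∈ S then Nat.find h else 0

/-- The last element of `S` strictly before `i`, cyclically. -/
noncomputable def prevIn (S : Finset (ZMod m)) (i : ZMod m) : ZMod m :=
  i - (distFrom S i : ZMod m)

/-- The set `A(T)` of anticlockwise switches: labels `i` with the interval
ending at `i` oriented in (`-1`) and the interval starting at `i` oriented
out (`+1`). -/
noncomputable def Acal (T : GLStar m) : Finset (ZMod m) :=
  T.labels.filter fun i => T.omega (prevIn T.labels i) = -1 ∧ T.omega i = 1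

/-- The set `C(T)` of clockwise switches. -/
noncomputable def Ccal (T : GLStar m) : Finset (ZMod m) :=
  T.labels.filter fun i => T.omega (prevIn T.labels i) = 1 ∧ T.omega i = -1

/-- The conjugate star `conj T`: all dual orientations reversed. -/
def conj (T : GLStar m) : GLStar m :=
  ⟨T.labels, T.sign, T.chi, fun i => -T.omega i⟩

/-- A star is nontrivial if its dual orientation is nonconstant on its labels. -/
def IsNontrivial (T : GLStar m) : Prop :=
  ∃ i ∈ T.labels, ∃ j ∈ T.labels, T.omega i ≠ T.omega j

/-- A star is coherent if `chi` is constant on `A(T)` and constant on `C(T)`. -/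
noncomputable def IsCoherent (T : GLStar m) : Prop :=
  (∀ a ∈ Acal T, ∀ b ∈ Acal T, T.chi a = T.chi b) ∧
  (∀ a ∈ Ccal T, ∀ b ∈ Ccal T, T.chi a = T.chi b)

/-- The positive derivative `d⁺T`: labels are the clockwise switches of `T`,
with inherited characters; the interval starting at `c ∈ C(T)` is oriented by
`χ(a)` for the unique `a ∈ A(T)` in that interval (which is the first element
of `A(T)` after `c`). -/
noncomputable def dPlus (T : GLStar m) : GLStar m :=
  ⟨Ccal T, T.sign, T.chi, fun i => T.chi (nextIn (Acal T) i)⟩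

/-- The negative derivative `d⁻T = conj (d⁺T)`. -/
noncomputable def dMinus (T : GLStar m) : GLStar m := conj (dPlus T)

end GLStar

namespace GLStar

theorem nextIn_eq {m : ℕ} (S : Finset (ZMod m)) (i : ZMod m) (k : ℕ) (h0 : 0 < k) (hm : k ≤ m)
    (hk : i + (k : ZMod m) ∈ S) (hmin : ∀ e : ℕ, 0 < e → e < k → i + (e : ZMod m) ∉ S) :
    nextIn S i = i + (k : ZMod m) := by
  classical
  have h : ∃ k : ℕ, 0 < k ∧ k ≤ m ∧ i + (k : ZMod m) ∈ S := ⟨k, h0, hm, hk⟩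
  have hd : distTo S i = k := by
    unfold distTo
    rw [dif_pos h, Nat.find_eq_iff]
    exact ⟨⟨h0, hm, hk⟩, fun e he hh => hmin e hh.1 he hh.2.2⟩
  rw [nextIn, hd]

theorem prevIn_eq {m : ℕ} (S : Finset (ZMod m)) (i : ZMod m) (k : ℕ) (h0 : 0 < k) (hm : k ≤ m)
    (hk : i - (k : ZMod m) ∈ S) (hmin : ∀ e : ℕ, 0 < e → e < k → i - (e : ZMod m) ∉ S) :
    prevIn S i = i - (k : ZMod m) := by
  classical
  have h : ∃ k : ℕ, 0 < k ∧ k ≤ m ∧ i - (k : ZMod m) ∈ S := ⟨k, h0, hm, hk⟩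
  have hd : distFrom S i = k := by
    unfold distFrom
    rw [dif_pos h, Nat.find_eq_iff]
    exact ⟨⟨h0, hm, hk⟩, fun e he hh => hmin e hh.1 he hh.2.2⟩
  rw [prevIn, hd]

theorem exists_pred {m : ℕ} [NeZero m] (T : GLStar m) (a : ZMod m) (ha : a ∈ Acal T) :
    ∃ c ∈ Ccal T, nextIn (Acal T) c = a := by
  classical
  have ha' := ha
  simp only [Acal, Finset.mem_filter] at ha'
  obtain ⟨haS, hap, haw⟩ := ha'
  have hm0 : 0 < m := Nat.pos_of_ne_zero (NeZero.ne m)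
  have hex : ∃ k : ℕ, 0 < k ∧ a - (k : ZMod m) ∈ T.labels ∧ T.omega (a - (k : ZMod m)) = 1 :=
    ⟨m, hm0, by simpa using haS, by simpa using haw⟩
  obtain ⟨k, ⟨hk0, hkS, hkw⟩, hkmin⟩ :
      ∃ k : ℕ, (0 < k ∧ a - (k : ZMod m) ∈ T.labels ∧ T.omega (a - (k : ZMod m)) = 1) ∧
        ∀ e : ℕ, e < k →
          ¬ (0 < e ∧ a - (e : ZMod m) ∈ T.labels ∧ T.omega (a - (e : ZMod m)) = 1) :=
    ⟨Nat.find hex, Nat.find_spec hex, fun e he => Nat.find_min hex he⟩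
  have hkm : k ≤ m := by
    by_contra hlt
    exact hkmin m (by omega) ⟨hm0, by simpa using haS, by simpa using haw⟩
  have hex2 : ∃ d : ℕ, 0 < d ∧ a - (k : ZMod m) + (d : ZMod m) ∈ T.labels :=
    ⟨k, hk0, by simpa using haS⟩
  obtain ⟨d, ⟨hd0, hdS⟩, hdmin⟩ :
      ∃ d : ℕ, (0 < d ∧ a - (k : ZMod m) + (d : ZMod m) ∈ T.labels) ∧
        ∀ e : ℕ, e < d → ¬ (0 < e ∧ a - (k : ZMod m) + (e : ZMod m) ∈ T.labels) :=
    ⟨Nat.find hex2, Nat.find_spec hex2, fun e he => Nat.find_min hex2 he⟩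
  have hdk : d ≤ k := by
    by_contra hlt
    exact hdmin k (by omega) ⟨hk0, by simpa using haS⟩
  have hprev : prevIn T.labels (a - (k : ZMod m) + (d : ZMod m)) = a - (k : ZMod m) := by
    rw [prevIn_eq T.labels _ d hd0 (by omega) (by simpa using hkS)]
    · ring
    · intro e he0 hed hmem
      apply hdmin (d - e) (by omega)
      refine ⟨by omega, ?_⟩
      rw [Nat.cast_sub hed.le]
      convert hmem using 1
      ring
  have hne : d ≠ k := by
    rintro rfl
    rw [sub_add_cancel] at hprev
    rw [hprev, hkw] at hap
    exact absurd hap (by decide)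
  have hlt : d < k := by omega
  refine ⟨a - (k : ZMod m) + (d : ZMod m), ?_, ?_⟩
  · simp only [Ccal, Finset.mem_filter]
    refine ⟨hdS, by rw [hprev, hkw], ?_⟩
    rcases Int.units_eq_one_or (T.omega (a - (k : ZMod m) + (d : ZMod m))) with h | h
    · exfalso
      have e1 : a - ((k - d : ℕ) : ZMod m) = a - (k : ZMod m) + (d : ZMod m) := by
        rw [Nat.cast_sub hdk]; ring
      exact hkmin (k - d) (by omega) ⟨by omega, by rw [e1]; exact hdS, by rw [e1]; exact h⟩
    · exact h
  · have e2 : a - (k : ZMod m) + (d : ZMod m) + ((k - d : ℕ) : ZMod m) = a := by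
      rw [Nat.cast_sub hdk]; ring
    rw [nextIn_eq (Acal T) _ (k - d) (by omega) (by omega) (by rw [e2]; exact ha), e2]
    intro e he0 hek hmem
    have e3 : a - (k : ZMod m) + (d : ZMod m) + (e : ZMod m) = a - ((k - d - e : ℕ) : ZMod m) := by
      rw [Nat.cast_sub hek.le, Nat.cast_sub hdk]; ring
    rw [e3] at hmem
    simp only [Acal, Finset.mem_filter] at hmem
    exact hkmin (k - d - e) (by omega) ⟨by omega, hmem.1, hmem.2.2⟩

theorem conj_conj {m : ℕ} (T : GLStar m) : conj (conj T) = T := by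
  simp [conj]

theorem Acal_conj {m : ℕ} (T : GLStar m) : Acal (conj T) = Ccal T := by
  simp [Acal, Ccal, conj, neg_eq_iff_eq_neg]

theorem conj_nontrivial {m : ℕ} (T : GLStar m) (h : T.IsNontrivial) :
    (conj T).IsNontrivial := by
  obtain ⟨i, hi, j, hj, hij⟩ := h
  exact ⟨i, hi, j, hj, fun h => hij (neg_injective h)⟩

theorem dPlus_good {m : ℕ} [NeZero m] (T : GLStar m)
    (h : ∃ a ∈ Acal T, ∃ b ∈ Acal T, T.chi a ≠ T.chi b) :
    (dPlus T).IsNontrivial ∧ (dPlus T).labels.card < T.labels.card := by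
  obtain ⟨a, ha, b, hb, hab⟩ := h
  constructor
  · obtain ⟨c, hc, hca⟩ := exists_pred T a ha
    obtain ⟨d, hd, hdb⟩ := exists_pred T b hb
    refine ⟨c, hc, d, hd, ?_⟩
    simpa [dPlus, hca, hdb] using hab
  · apply Finset.card_lt_card
    refine (Finset.ssubset_iff_of_subset (Finset.filter_subset _ T.labels : Ccal T ⊆ T.labels)).2 ?_
    simp only [Acal, Finset.mem_filter] at ha
    refine ⟨a, ha.1, fun h => ?_⟩
    have h2 := (Finset.mem_filter.1 h).2.2
    rw [ha.2.2] at h2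
    exact absurd h2 (by decide)

theorem main_aux {m : ℕ} [NeZero m] (N : ℕ) :
    ∀ T : GLStar m, T.labels.card = N → T.IsNontrivial →
    ∃ n : ℕ, 1 ≤ n ∧ ∃ Ts : ℕ → GLStar m,
      (Ts 1 = T ∨ Ts 1 = GLStar.conj T) ∧
      (∀ i, 2 ≤ i → i ≤ n → Ts i = dPlus (Ts (i - 1)) ∨ Ts i = dMinus (Ts (i - 1))) ∧
      (∀ i, 1 ≤ i → i ≤ n → (Ts i).IsNontrivial) ∧
      (Ts n).IsCoherent := by
  induction N using Nat.strong_induction_on with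
  | _ N ih =>
  intro T hN hT
  by_cases hco : T.IsCoherent
  · exact ⟨1, le_rfl, fun _ => T, Or.inl rfl, fun i h1 h2 => by omega, fun _ _ _ => hT, hco⟩
  obtain ⟨U, hU, hUn, hUc, hUA⟩ : ∃ U : GLStar m, (U = T ∨ U = conj T) ∧ U.IsNontrivial ∧
      U.labels.card = N ∧ ∃ a ∈ Acal U, ∃ b ∈ Acal U, U.chi a ≠ U.chi b := by
    by_cases hA : ∃ a ∈ Acal T, ∃ b ∈ Acal T, T.chi a ≠ T.chi b
    · exact ⟨T, Or.inl rfl, hT, hN, hA⟩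
    · refine ⟨conj T, Or.inr rfl, conj_nontrivial T hT, hN, ?_⟩
      rw [Acal_conj]
      by_contra hC
      push Not at hA hC
      exact hco ⟨hA, hC⟩
  obtain ⟨hn, hc⟩ := dPlus_good U hUA
  obtain ⟨n, hn1, Ts, h1, h2, h3, h4⟩ := ih _ (hUc ▸ hc) (dPlus U) rfl hn
  refine ⟨n + 1, by omega, fun i => if i ≤ 1 then U else Ts (i - 1), by simpa using hU, ?_, ?_, ?_⟩
  · intro i hi hin
    have hi1 : ¬ i ≤ 1 := by omega
    rcases Nat.lt_or_ge 2 i with h | h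
    · have hi2 : ¬ i - 1 ≤ 1 := by omega
      simp only [hi1, hi2, if_false]
      exact h2 (i - 1) (by omega) (by omega)
    · obtain rfl : i = 2 := by omega
      simpa [dMinus] using h1
  · intro i hi hin
    by_cases hi1 : i ≤ 1
    · simpa [hi1] using hUn
    · simp only [hi1, if_false]
      exact h3 (i - 1) (by omega) (by omega)
  · have : ¬ n + 1 ≤ 1 := by omega
    simpa only [this, if_false, Nat.add_sub_cancel] using h4

end GLStar

open GLStar in
/-- every nontrivial `L`-type has a sequence of coherence:
for every nontrivial star `T` (on the full label set `ZMod m`, `m ≥ 1`) there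
are `n ≥ 1` and stars `T_1, …, T_n` such that `T_1 ∈ {T, conj T}`, each
`T_i` (`2 ≤ i ≤ n`) is `d⁺T_{i-1}` or `d⁻T_{i-1}`, every `T_i` (`1 ≤ i ≤ n`)
is nontrivial, and `T_n` is coherent. -/
theorem exists_sequence_of_coherence {m : ℕ} [NeZero m]
    (T : GLStar m) (hfull : T.labels = Finset.univ) (hT : T.IsNontrivial) :
    ∃ n : ℕ, 1 ≤ n ∧ ∃ Ts : ℕ → GLStar m,
      (Ts 1 = T ∨ Ts 1 = GLStar.conj T) ∧
      (∀ i, 2 ≤ i → i ≤ n → Ts i = dPlus (Ts (i - 1)) ∨ Ts i = dMinus (Ts (i - 1))) ∧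
      (∀ i, 1 ≤ i → i ≤ n → (Ts i).IsNontrivial) ∧
      (Ts n).IsCoherent := by
  exact GLStar.main_aux _ T rfl hT
end

section
/- Let T be a star on labels ZMod m and L₀ ⊆ ZMod m. Let D = d^{ε_k} ∘ ⋯ ∘ d^{ε_1} be any composition of positive and negative derivatives (ε_j ∈ {+, −}) and let D₀ = d₀^{ε_k} ∘ ⋯ ∘ d₀^{ε_1} be the corresponding composition of derivatives relative to L₀, and assume every star arising at each stage of both compositions is nontrivial. Then C(DT) ⊆ C(D₀T) and Ã(DT) ⊇ Ã(D₀T), as subsets of ZMod m. -/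
namespace GLStar

variable {m : ℕ}

/-- `d⁺` or `d⁻` according to a sign `b` (`true` = positive). -/
noncomputable def dSigned (b : Bool) (T : GLStar m) : GLStar m :=
  if b then dPlus T else dMinus T

/-- The derivative of `T` relative to a label set `L₀`, with sign `ε`
(`ε = 1` for `d₀⁺`, `ε = -1` for `d₀⁻`): labels are `C(T) ∪ L₀` with
inherited characters; an interval between consecutive labels of `C(T) ∪ L₀`
which contains (strictly inside) an element `a` of `A(T)` is oriented by
`ε * χ(a)`, and otherwise keeps the (constant) orientation of `ω` there. -/
noncomputable def dRel (L₀ : Finset (ZMod m)) (ε : ℤˣ) (T : GLStar m) : GLStar m :=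
  ⟨Ccal T ∪ L₀, T.sign, T.chi, fun i =>
    if 0 < distTo (Acal T) i ∧ distTo (Acal T) i < distTo (Ccal T ∪ L₀) i then
      ε * T.chi (nextIn (Acal T) i)
    else T.omega i⟩

/-- `d₀⁺` or `d₀⁻` according to a sign `b` (`true` = positive). -/
noncomputable def dRelSigned (L₀ : Finset (ZMod m)) (b : Bool) (T : GLStar m) : GLStar m :=
  dRel L₀ (if b then 1 else -1) T

end GLStar

namespace GLStar

variable {m : ℕ}

theorem distTo_le' {S : Finset (ZMod m)} {i : ZMod m} {k : ℕ} (h0 : 0 < k) (h1 : k ≤ m)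
    (h : i + (k : ZMod m) ∈ S) : 0 < distTo S i ∧ distTo S i ≤ k := by
  classical
  unfold distTo
  have hex : ∃ k : ℕ, 0 < k ∧ k ≤ m ∧ i + (k : ZMod m) ∈ S := ⟨k, h0, h1, h⟩
  rw [dif_pos hex]
  exact ⟨(Nat.find_spec hex).1, Nat.find_le ⟨h0, h1, h⟩⟩

theorem distTo_mem' {S : Finset (ZMod m)} {i : ZMod m} (h0 : 0 < distTo S i) :
    distTo S i ≤ m ∧ i + (distTo S i : ZMod m) ∈ S := by
  classical
  unfold distTo at *
  split_ifs at h0 ⊢ with hex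
  · exact (Nat.find_spec hex).2
  · omega

theorem distTo_min' {S : Finset (ZMod m)} {i : ZMod m} {t : ℕ} (h0 : 0 < t)
    (h1 : t < distTo S i) : i + (t : ZMod m) ∉ S := by
  intro h
  have h2 := (distTo_mem' (S := S) (i := i) (by omega)).1
  have := (distTo_le' h0 (by omega) h).2
  omega

theorem distTo_eq' {S : Finset (ZMod m)} {i : ZMod m} {k : ℕ} (h0 : 0 < k) (h1 : k ≤ m)
    (h : i + (k : ZMod m) ∈ S) (hmin : ∀ t : ℕ, 0 < t → t < k → i + (t : ZMod m) ∉ S) :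
    distTo S i = k := by
  obtain ⟨a, b⟩ := distTo_le' h0 h1 h
  rcases Nat.lt_or_ge (distTo S i) k with hl | hl
  · exact absurd (distTo_mem' a).2 (hmin _ a hl)
  · omega

theorem distFrom_eq' {S : Finset (ZMod m)} {i : ZMod m} {k : ℕ} (h0 : 0 < k) (h1 : k ≤ m)
    (h : i - (k : ZMod m) ∈ S) (hmin : ∀ t : ℕ, 0 < t → t < k → i - (t : ZMod m) ∉ S) :
    distFrom S i = k := by
  classical
  unfold distFrom
  have hex : ∃ k : ℕ, 0 < k ∧ k ≤ m ∧ i - (k : ZMod m) ∈ S := ⟨k, h0, h1, h⟩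
  rw [dif_pos hex, Nat.find_eq_iff]
  refine ⟨⟨h0, h1, h⟩, ?_⟩
  rintro n hn ⟨a, b, c⟩
  exact hmin n a hn c

theorem distFrom_spec' [NeZero m] {S : Finset (ZMod m)} (hS : S.Nonempty) (i : ZMod m) :
    0 < distFrom S i ∧ distFrom S i ≤ m ∧ i - (distFrom S i : ZMod m) ∈ S ∧
      ∀ t : ℕ, 0 < t → t < distFrom S i → i - (t : ZMod m) ∉ S := by
  classical
  obtain ⟨x, hx⟩ := hS
  have hm : 0 < m := Nat.pos_of_ne_zero (NeZero.ne m)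
  have hex : ∃ k : ℕ, 0 < k ∧ k ≤ m ∧ i - (k : ZMod m) ∈ S := by
    by_cases h : (i - x).val = 0
    · refine ⟨m, hm, le_rfl, ?_⟩
      rw [ZMod.val_eq_zero, sub_eq_zero] at h
      simpa [h] using hx
    · refine ⟨(i - x).val, by omega, (ZMod.val_lt _).le, ?_⟩
      simpa using hx
  unfold distFrom
  rw [dif_pos hex]
  obtain ⟨a, b, c⟩ := Nat.find_spec hex
  refine ⟨a, b, c, fun t h0 h1 h => ?_⟩
  exact Nat.find_min hex h1 ⟨h0, by omega, h⟩

/-- orientation of the ambient unit interval from `i` to `i+1` -/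
noncomputable def ext (T : GLStar m) (i : ZMod m) : ℤˣ := T.omega (prevIn T.labels (i + 1))

theorem ext_pred (T : GLStar m) (i : ZMod m) : T.ext (i - 1) = T.omega (prevIn T.labels i) := by
  simp [ext]

theorem ext_of_mem [NeZero m] (T : GLStar m) {i : ZMod m} (hi : i ∈ T.labels) :
    T.ext i = T.omega i := by
  have hm : 0 < m := Nat.pos_of_ne_zero (NeZero.ne m)
  have : distFrom T.labels (i + 1) = 1 :=
    distFrom_eq' one_pos hm (by simpa using hi) (by intro t h0 h1; omega)
  simp [ext, prevIn, this]

theorem ext_of_notMem [NeZero m] (T : GLStar m) (hne : T.labels.Nonempty) {i : ZMod m}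
    (hi : i ∉ T.labels) : T.ext i = T.ext (i - 1) := by
  obtain ⟨a, b, c, d⟩ := distFrom_spec' hne i
  have hne : distFrom T.labels i ≠ m := by
    intro h
    rw [h] at c
    simp at c
    exact hi c
  have : distFrom T.labels (i + 1) = distFrom T.labels i + 1 := by
    refine distFrom_eq' (by omega) (by omega) (by simpa using c) ?_
    intro t h0 h1
    rcases Nat.exists_eq_succ_of_ne_zero h0.ne' with ⟨t, rfl⟩
    rcases Nat.eq_zero_or_pos t with rfl | ht
    · simpa using hi
    · have := d t ht (by omega)
      simpa using this
  rw [ext_pred, ext, prevIn, prevIn, this]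
  simp

theorem mem_A [NeZero m] {T : GLStar m} (hne : T.labels.Nonempty) {i : ZMod m} :
    i ∈ Acal T ↔ T.ext (i - 1) = -1 ∧ T.ext i = 1 := by
  by_cases hi : i ∈ T.labels
  · simp [Acal, hi, ext_pred, ext_of_mem]
  · simp only [Acal, Finset.mem_filter, hi, false_and, false_iff, ext_of_notMem T hne hi]
    rintro ⟨h1, h2⟩
    rw [h1] at h2
    exact absurd h2 (by decide)

theorem mem_C [NeZero m] {T : GLStar m} (hne : T.labels.Nonempty) {i : ZMod m} :
    i ∈ Ccal T ↔ T.ext (i - 1) = 1 ∧ T.ext i = -1 := by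
  by_cases hi : i ∈ T.labels
  · simp [Ccal, hi, ext_pred, ext_of_mem]
  · simp only [Ccal, Finset.mem_filter, hi, false_and, false_iff, ext_of_notMem T hne hi]
    rintro ⟨h1, h2⟩
    rw [h1] at h2
    exact absurd h2 (by decide)

theorem prop_A [NeZero m] {T : GLStar m} (hne : T.labels.Nonempty) {i : ZMod m}
    (h : T.ext i = -1) (j : ℕ) (hj : ∀ t : ℕ, 0 < t → t ≤ j → i + (t : ZMod m) ∉ Acal T) :
    T.ext (i + (j : ZMod m)) = -1 := by
  induction j with
  | zero => simpa using h
  | succ j ih =>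
    have h1 := ih (fun t h0 h1 => hj t h0 (by omega))
    have h2 := hj (j + 1) (by omega) le_rfl
    rw [mem_A hne] at h2
    have e : i + ((j + 1 : ℕ) : ZMod m) - 1 = i + (j : ZMod m) := by push_cast; ring
    rw [e] at h2
    rcases Int.units_eq_one_or (T.ext (i + ((j + 1 : ℕ) : ZMod m))) with h3 | h3
    · exact absurd ⟨h1, h3⟩ h2
    · exact h3

theorem prop_C [NeZero m] {T : GLStar m} (hne : T.labels.Nonempty) {i : ZMod m}
    (h : T.ext i = 1) (j : ℕ) (hj : ∀ t : ℕ, 0 < t → t ≤ j → i + (t : ZMod m) ∉ Ccal T) :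
    T.ext (i + (j : ZMod m)) = 1 := by
  induction j with
  | zero => simpa using h
  | succ j ih =>
    have h1 := ih (fun t h0 h1 => hj t h0 (by omega))
    have h2 := hj (j + 1) (by omega) le_rfl
    rw [mem_C hne] at h2
    have e : i + ((j + 1 : ℕ) : ZMod m) - 1 = i + (j : ZMod m) := by push_cast; ring
    rw [e] at h2
    rcases Int.units_eq_one_or (T.ext (i + ((j + 1 : ℕ) : ZMod m))) with h3 | h3
    · exact h3
    · exact absurd ⟨h1, h3⟩ h2

/-- between two anticlockwise switches there is a clockwise one -/
theorem exists_C [NeZero m] {T : GLStar m} (hne : T.labels.Nonempty) {i : ZMod m} {j : ℕ}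
    (h0 : 0 < j) (hi : i ∈ Acal T) (hj : i + (j : ZMod m) ∈ Acal T) :
    ∃ t : ℕ, 0 < t ∧ t < j ∧ i + (t : ZMod m) ∈ Ccal T := by
  by_contra hcon
  push Not at hcon
  have h1 := prop_C hne ((mem_A hne).1 hi).2 (j - 1) (fun t a b => hcon t a (by omega))
  have h2 := ((mem_A hne).1 hj).1
  have e : i + ((j - 1 : ℕ) : ZMod m) = i + (j : ZMod m) - 1 := by
    rw [Nat.cast_sub h0]; push_cast; ring
  rw [e, h2] at h1
  exact absurd h1 (by decide)

/-- common form of the two derivatives -/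
noncomputable def dEps (ε : ℤˣ) (T : GLStar m) : GLStar m :=
  ⟨Ccal T, T.sign, T.chi, fun i => ε * T.chi (nextIn (Acal T) i)⟩

theorem dSigned_eq (b : Bool) (T : GLStar m) : dSigned b T = dEps (if b then 1 else -1) T := by
  cases b <;> simp [dSigned, dEps, dMinus, dPlus, conj]

theorem S_fwd [NeZero m] {T : GLStar m} (hne : T.labels.Nonempty) (ε : ℤˣ) {c : ZMod m}
    (hc : c ∈ Ccal T) {j : ℕ} (h0 : 0 < j) (hm : j ≤ m) (hA : c + (j : ZMod m) ∈ Acal T)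
    (hC : ∀ t : ℕ, 0 < t → t ≤ j → c + (t : ZMod m) ∉ Ccal T) :
    (dEps ε T).ext c = ε * T.chi (c + (j : ZMod m)) := by
  rw [ext_of_mem (dEps ε T) hc]
  have : distTo (Acal T) c = j := by
    refine distTo_eq' h0 hm hA ?_
    intro t h1 h2 h3
    have e : c + (t : ZMod m) + ((j - t : ℕ) : ZMod m) = c + (j : ZMod m) := by
      rw [Nat.cast_sub h2.le]; ring
    obtain ⟨s, s0, s1, s2⟩ := exists_C hne (j := j - t) (by omega) h3 (by rw [e]; exact hA)
    refine hC (t + s) (by omega) (by omega) ?_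
    push_cast
    rwa [← add_assoc]
  simp [dEps, nextIn, this]

theorem S_bwd [NeZero m] {T : GLStar m} (hne : T.labels.Nonempty) (ε : ℤˣ) {c : ZMod m}
    (hc : c ∈ Ccal T) {j : ℕ} (h0 : 0 < j) (hA : c - (j : ZMod m) ∈ Acal T)
    (hm : j ≤ m)
    (hC : ∀ t : ℕ, 0 < t → t ≤ j → c - (t : ZMod m) ∉ Ccal T) :
    (dEps ε T).ext (c - 1) = ε * T.chi (c - (j : ZMod m)) := by
  rw [ext_pred]
  obtain ⟨a, b, hq, hmin⟩ := distFrom_spec' ⟨c, hc⟩ c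
  change (dEps ε T).omega (prevIn (Ccal T) c) = _
  unfold prevIn
  set d := distFrom (Ccal T) c with hd
  have hjd : j < d := by
    by_contra hcon
    exact hC d a (by omega) hq
  have e : c - (d : ZMod m) + ((d - j : ℕ) : ZMod m) = c - (j : ZMod m) := by
    rw [Nat.cast_sub hjd.le]; ring
  have : distTo (Acal T) (c - (d : ZMod m)) = d - j := by
    refine distTo_eq' (by omega) (by omega) (by rw [e]; exact hA) ?_
    intro t h1 h2 h3
    have e2 : c - (d : ZMod m) + (t : ZMod m) + ((d - j - t : ℕ) : ZMod m) = c - (j : ZMod m) := by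
      rw [Nat.cast_sub h2.le, Nat.cast_sub hjd.le]; ring
    obtain ⟨s, s0, s1, s2⟩ := exists_C hne (j := d - j - t) (by omega) h3 (by rw [e2]; exact hA)
    refine hmin (d - t - s) (by omega) (by omega) ?_
    rw [Nat.cast_sub (by omega), Nat.cast_sub (by omega)]
    convert s2 using 1
    ring
  simp only [dEps, nextIn, this, e]

theorem R_fwd [NeZero m] {T : GLStar m} (hne : T.labels.Nonempty) (L₀ : Finset (ZMod m))
    (ε : ℤˣ) {c : ZMod m} (hc : c ∈ Ccal T) :
    (dRel L₀ ε T).ext c = -1 ∨ ∃ j : ℕ, 0 < j ∧ j ≤ m ∧ c + (j : ZMod m) ∈ Acal T ∧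
      (dRel L₀ ε T).ext c = ε * T.chi (c + (j : ZMod m)) ∧
      ∀ t : ℕ, 0 < t → t ≤ j → c + (t : ZMod m) ∉ Ccal T ∪ L₀ := by
  have hcl : c ∈ (dRel L₀ ε T).labels := Finset.mem_union_left _ hc
  rw [ext_of_mem _ hcl]
  by_cases h : 0 < distTo (Acal T) c ∧ distTo (Acal T) c < distTo (Ccal T ∪ L₀) c
  · right
    obtain ⟨h1, h2⟩ := distTo_mem' h.1
    refine ⟨distTo (Acal T) c, h.1, h1, h2, ?_, ?_⟩
    · simp only [dRel]
      rw [if_pos h]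
      rfl
    · intro t t0 t1
      exact distTo_min' t0 (by omega)
  · left
    simp only [dRel]
    rw [if_neg h, ← ext_of_mem T (Finset.mem_filter.1 hc).1]
    exact ((mem_C hne).1 hc).2

theorem R_bwd [NeZero m] {T : GLStar m} (hne : T.labels.Nonempty) (L₀ : Finset (ZMod m))
    (hL : L₀ ⊆ T.labels)
    (ε : ℤˣ) {c : ZMod m} (hc : c ∈ Ccal T) :
    (dRel L₀ ε T).ext (c - 1) = 1 ∨ ∃ j : ℕ, 0 < j ∧ j ≤ m ∧ c - (j : ZMod m) ∈ Acal T ∧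
      (dRel L₀ ε T).ext (c - 1) = ε * T.chi (c - (j : ZMod m)) ∧
      ∀ t : ℕ, 0 < t → t ≤ j → c - (t : ZMod m) ∉ Ccal T ∪ L₀ := by
  have hcl : c ∈ Ccal T ∪ L₀ := Finset.mem_union_left _ hc
  rw [ext_pred]
  change (dRel L₀ ε T).omega (prevIn (Ccal T ∪ L₀) c) = _ ∨ ∃ j : ℕ, 0 < j ∧ j ≤ m ∧ _ ∧
    (dRel L₀ ε T).omega (prevIn (Ccal T ∪ L₀) c) = _ ∧ _
  obtain ⟨a, b, hp, hmin⟩ := distFrom_spec' ⟨c, hcl⟩ c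
  unfold prevIn
  set d := distFrom (Ccal T ∪ L₀) c with hd
  set p := c - (d : ZMod m) with hpdef
  have hpd : p + (d : ZMod m) = c := by rw [hpdef]; ring
  have hdt : distTo (Ccal T ∪ L₀) p = d := by
    refine distTo_eq' a b (by rwa [hpd]) ?_
    intro t h1 h2 h3
    refine hmin (d - t) (by omega) (by omega) ?_
    rw [Nat.cast_sub h2.le]
    convert h3 using 1
    rw [hpdef]; ring
  by_cases h : 0 < distTo (Acal T) p ∧ distTo (Acal T) p < distTo (Ccal T ∪ L₀) p
  · right
    obtain ⟨h1, h2⟩ := distTo_mem' h.1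
    have hlt : distTo (Acal T) p < d := by omega
    have e : c - ((d - distTo (Acal T) p : ℕ) : ZMod m) = p + (distTo (Acal T) p : ZMod m) := by
      rw [Nat.cast_sub hlt.le, hpdef]; ring
    refine ⟨d - distTo (Acal T) p, by omega, by omega, by rwa [e], ?_, ?_⟩
    · rw [e]
      simp only [dRel]
      rw [if_pos h]
      rfl
    · intro t t0 t1
      exact hmin t t0 (by omega)
  · left
    have hpl : p ∈ T.labels := by
      rcases Finset.mem_union.1 hp with h | h
      · exact (Finset.mem_filter.1 h).1
      · exact hL h
    simp only [dRel]
    rw [if_neg h, ← ext_of_mem T hpl]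
    rcases Int.units_eq_one_or (T.ext p) with h3 | h3
    · exact h3
    · exfalso
      have h4 := prop_A hne h3 (d - 1) (by
        intro t t0 t1 t2
        have := distTo_le' t0 (by omega) t2
        exact h ⟨this.1, by omega⟩)
      have e : p + ((d - 1 : ℕ) : ZMod m) = c - 1 := by
        rw [Nat.cast_sub (by omega), hpdef]; push_cast; ring
      rw [e, ((mem_C hne).1 hc).1] at h4
      exact absurd h4 (by decide)

theorem step [NeZero m] {S R : GLStar m} (hS : S.labels.Nonempty) (hR : R.labels.Nonempty)
    (L₀ : Finset (ZMod m)) (hL : L₀ ⊆ R.labels) (ε : ℤˣ) (hchi : S.chi = R.chi)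
    (hC : Ccal S ⊆ Ccal R) (hA : Acal R \ L₀ ⊆ Acal S)
    (hS' : (dEps ε S).labels.Nonempty) (hR' : (dRel L₀ ε R).labels.Nonempty) :
    Ccal (dEps ε S) ⊆ Ccal (dRel L₀ ε R) ∧ Acal (dRel L₀ ε R) \ L₀ ⊆ Acal (dEps ε S) := by
  constructor
  · intro c hc
    have hcS : c ∈ Ccal S := (Finset.mem_filter.1 hc).1
    obtain ⟨h1, h2⟩ := (mem_C hS').1 hc
    rw [mem_C hR']
    constructor
    · rcases R_bwd hR L₀ hL ε (hC hcS) with h | ⟨j, j0, jm, jA, je, jn⟩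
      · exact h
      · have hb : c - (j : ZMod m) ∈ Acal S :=
          hA (Finset.mem_sdiff.2 ⟨jA, fun h => jn j j0 le_rfl (Finset.mem_union_right _ h)⟩)
        rw [je, ← hchi, ← S_bwd hS ε hcS j0 hb jm
          (fun t a b h => jn t a b (Finset.mem_union_left _ (hC h)))]
        exact h1
    · rcases R_fwd hR L₀ ε (hC hcS) with h | ⟨j, j0, jm, jA, je, jn⟩
      · exact h
      · have hb : c + (j : ZMod m) ∈ Acal S :=
          hA (Finset.mem_sdiff.2 ⟨jA, fun h => jn j j0 le_rfl (Finset.mem_union_right _ h)⟩)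
        rw [je, ← hchi, ← S_fwd hS ε hcS j0 jm hb
          (fun t a b h => jn t a b (Finset.mem_union_left _ (hC h)))]
        exact h2
  · intro c hc
    obtain ⟨hc, hcL⟩ := Finset.mem_sdiff.1 hc
    have hcR : c ∈ Ccal R := by
      rcases Finset.mem_union.1 (Finset.mem_filter.1 hc).1 with h | h
      · exact h
      · exact absurd h hcL
    obtain ⟨h1, h2⟩ := (mem_A hR').1 hc
    rcases R_bwd hR L₀ hL ε hcR with h | ⟨j, j0, jm, jA, je, jn⟩
    · rw [h1] at h; exact absurd h (by decide)
    rcases R_fwd hR L₀ ε hcR with h | ⟨l, l0, lm, lA, le, ln⟩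
    · rw [h2] at h; exact absurd h (by decide)
    have hb : c - (j : ZMod m) ∈ Acal S :=
      hA (Finset.mem_sdiff.2 ⟨jA, fun h => jn j j0 le_rfl (Finset.mem_union_right _ h)⟩)
    have hb' : c + (l : ZMod m) ∈ Acal S :=
      hA (Finset.mem_sdiff.2 ⟨lA, fun h => ln l l0 le_rfl (Finset.mem_union_right _ h)⟩)
    have hcS : c ∈ Ccal S := by
      have e : c - (j : ZMod m) + ((j + l : ℕ) : ZMod m) = c + (l : ZMod m) := by
        push_cast; ring
      obtain ⟨t, t0, t1, t2⟩ := exists_C hS (j := j + l) (by omega) hb (by rwa [e])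
      rcases lt_trichotomy t j with h | h | h
      · exfalso
        refine jn (j - t) (by omega) (by omega) (Finset.mem_union_left _ (hC ?_))
        rw [Nat.cast_sub h.le]
        convert t2 using 1
        ring
      · subst h
        simpa using t2
      · exfalso
        refine ln (t - j) (by omega) (by omega) (Finset.mem_union_left _ (hC ?_))
        rw [Nat.cast_sub h.le]
        convert t2 using 1
        ring
    rw [mem_A hS']
    constructor
    · rw [S_bwd hS ε hcS j0 hb jm
          (fun t a b h => jn t a b (Finset.mem_union_left _ (hC h))), hchi, ← je]
      exact h1
    · rw [S_fwd hS ε hcS l0 lm hb'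
          (fun t a b h => ln t a b (Finset.mem_union_left _ (hC h))), hchi, ← le]
      exact h2

end GLStar

open GLStar in
/-- Gordon–Luecke 2.1.2: let `T` be a star on the full
label set `ZMod m` and `L₀ ⊆ ZMod m`.  Let `D = d^{ε_k} ∘ ⋯ ∘ d^{ε_1}` be a
composition of positive/negative derivatives and `D₀` the corresponding
composition of derivatives relative to `L₀`, all intermediate stars of both
compositions being nontrivial.  Then `C(DT) ⊆ C(D₀T)` and
`Ã(DT) ⊇ Ã(D₀T)` (where `Ã(T) = A(T) \ L₀`), as subsets of `ZMod m`. -/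
theorem Ccal_subset_and_Atilde_superset_of_relative_derivatives
    {m : ℕ} [NeZero m] (T : GLStar m) (hfull : T.labels = Finset.univ)
    (L₀ : Finset (ZMod m)) (k : ℕ) (ε : ℕ → Bool)
    (S R : ℕ → GLStar m)
    (hS0 : S 0 = T) (hR0 : R 0 = T)
    (hSstep : ∀ j < k, S (j + 1) = dSigned (ε j) (S j))
    (hRstep : ∀ j < k, R (j + 1) = dRelSigned L₀ (ε j) (R j))
    (hSnontriv : ∀ j ≤ k, (S j).IsNontrivial)
    (hRnontriv : ∀ j ≤ k, (R j).IsNontrivial) :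
    Ccal (S k) ⊆ Ccal (R k) ∧ Acal (R k) \ L₀ ⊆ Acal (S k) \ L₀ := by
  have key : ∀ j ≤ k, (S j).chi = (R j).chi ∧ L₀ ⊆ (R j).labels ∧
      Ccal (S j) ⊆ Ccal (R j) ∧ Acal (R j) \ L₀ ⊆ Acal (S j) := by
    intro j
    induction j with
    | zero =>
      intro _
      rw [hS0, hR0]
      exact ⟨rfl, by rw [hfull]; exact Finset.subset_univ _, fun _ h => h, Finset.sdiff_subset⟩
    | succ j ih =>
      intro hj
      obtain ⟨i1, i2, i3, i4⟩ := ih (by omega)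
      have ne : ∀ {U : GLStar m}, U.IsNontrivial → U.labels.Nonempty := by
        rintro U ⟨x, hx, _⟩
        exact ⟨x, hx⟩
      have n1 := ne (hSnontriv j (by omega))
      have n2 := ne (hRnontriv j (by omega))
      have n3 := ne (hSnontriv (j + 1) hj)
      have n4 := ne (hRnontriv (j + 1) hj)
      rw [hSstep j (by omega), dSigned_eq] at n3 ⊢
      rw [hRstep j (by omega), dRelSigned] at n4 ⊢
      exact ⟨i1, Finset.subset_union_right, step n1 n2 L₀ i2 _ i1 i3 i4 n3 n4⟩
  obtain ⟨-, -, h3, h4⟩ := key k le_rfl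
  refine ⟨h3, fun x hx => ?_⟩
  exact Finset.mem_sdiff.2 ⟨h4 hx, (Finset.mem_sdiff.1 hx).2⟩
end

section
/- Let T be a nontrivial star on labels ZMod m with a sequence of coherence (T_1, …, T_n), i.e., T_1 ∈ {T, conj(T)}, each T_i ∈ {d⁺T_{i−1}, d⁻T_{i−1}} for 2 ≤ i ≤ n, each T_i is nontrivial, and T_n is coherent. Let L₀ ⊆ ZMod m, and let (R_1, …, R_n) be the L₀-sequence obtained by setting R_1 = T_1 and R_i = d₀^{±}R_{i−1}, where at each step the sign ± of the relative derivative matches the sign of the corresponding derivative in the sequence of coherence; assume each R_i is nontrivial. Then all elements of Ã(R_n) = A(R_n) \ L₀ have the same character; in particular, no interval of R_n between cyclically consecutive L₀-labels contains two anticlockwise switches outside L₀ of differing characters (i.e., no such corner of R_n is ugly). -/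
namespace GLStar

variable {m : ℕ}

/-- integer lift of membership -/
def In (S : Finset (ZMod m)) (x : ℤ) : Prop := (x : ZMod m) ∈ S

theorem In_exists_next [NeZero m] (S : Finset (ZMod m)) (w x : ℤ) (hw : In S w) :
    ∃ y, x < y ∧ y ≤ x + m ∧ In S y ∧ ∀ z, x < z → z < y → ¬ In S z := by
  classical
  have hm : (0 : ℤ) < m := by exact_mod_cast Nat.pos_of_ne_zero (NeZero.ne m)
  have hex : ∃ k : ℕ, 0 < k ∧ k ≤ m ∧ In S (x + k) := by
    have h1 := Int.emod_nonneg (w - x - 1) hm.ne'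
    have h2 := Int.emod_lt_of_pos (w - x - 1) hm
    refine ⟨((w - x - 1) % m).toNat + 1, by omega, by omega, ?_⟩
    have : ((x + ((((w - x - 1) % m).toNat + 1 : ℕ) : ℤ) : ℤ) : ZMod m) = (w : ZMod m) := by
      rw [ZMod.intCast_eq_intCast_iff]
      have h3 := Int.emod_add_mul_ediv (w - x - 1) m
      rw [Int.modEq_iff_dvd]
      refine ⟨(w - x - 1) / m, ?_⟩
      push_cast
      rw [Int.toNat_of_nonneg h1]
      linarith
    unfold In at *
    rw [this]; exact hw
  obtain ⟨h1, h2, h3⟩ := Nat.find_spec hex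
  refine ⟨x + Nat.find hex, by omega, by omega, h3, ?_⟩
  intro z hz1 hz2 hz
  have := Nat.find_min hex (m := (z - x).toNat) (by omega)
  apply this
  refine ⟨by omega, by omega, ?_⟩
  have : x + ((z - x).toNat : ℤ) = z := by omega
  rw [this]; exact hz

theorem In_exists_prev [NeZero m] (S : Finset (ZMod m)) (w x : ℤ) (hw : In S w) :
    ∃ y, y < x ∧ x ≤ y + m ∧ In S y ∧ ∀ z, y < z → z < x → ¬ In S z := by
  classical
  obtain ⟨y, h1, h2, h3, h4⟩ := In_exists_next (S.image (fun i => -i)) (-w) (-x)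
    (by unfold In at *; simpa using hw)
  refine ⟨-y, by omega, by omega, by
    unfold In at *
    obtain ⟨v, hv, e⟩ := Finset.mem_image.1 h3
    push_cast
    rw [← e, neg_neg]; exact hv, ?_⟩
  intro z hz1 hz2 hz
  exact h4 (-z) (by omega) (by omega) (by unfold In at *; simpa using hz)

theorem In_add_m (S : Finset (ZMod m)) (x : ℤ) : In S (x + m) ↔ In S x := by
  unfold In; simp

theorem In_sub_m (S : Finset (ZMod m)) (x : ℤ) : In S (x - m) ↔ In S x := by
  unfold In; simp

theorem distTo_eq [NeZero m] (S : Finset (ZMod m)) (x y : ℤ) (h : x < y) (hy : In S y)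
    (hn : ∀ z, x < z → z < y → ¬ In S z) : (distTo S (x : ZMod m) : ℤ) = y - x := by
  classical
  have hm : (0 : ℤ) < m := by exact_mod_cast Nat.pos_of_ne_zero (NeZero.ne m)
  have hle : y ≤ x + m := by
    by_contra hc
    exact hn (y - m) (by omega) (by omega) ((In_sub_m S y).2 hy)
  have hex : ∃ k : ℕ, 0 < k ∧ k ≤ m ∧ (x : ZMod m) + (k : ZMod m) ∈ S := by
    refine ⟨(y - x).toNat, by omega, by omega, ?_⟩
    have e : ((x + ((y - x).toNat : ℤ) : ℤ) : ZMod m) ∈ S := by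
      rw [show x + ((y - x).toNat : ℤ) = y by omega]; exact hy
    rwa [Int.cast_add, Int.cast_natCast] at e
  have hd : distTo S (x : ZMod m) = Nat.find hex := by
    unfold distTo; rw [dif_pos hex]
  have hf : Nat.find hex = (y - x).toNat := by
    rw [Nat.find_eq_iff]
    refine ⟨⟨by omega, by omega, ?_⟩, ?_⟩
    · have e : ((x + ((y - x).toNat : ℤ) : ℤ) : ZMod m) ∈ S := by
        rw [show x + ((y - x).toNat : ℤ) = y by omega]; exact hy
      rwa [Int.cast_add, Int.cast_natCast] at e
    · rintro k hk ⟨h1, h2, h3⟩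
      refine hn (x + k) (by omega) (by omega) ?_
      unfold In; simpa using h3
  rw [hd, hf]; omega

theorem nextIn_eq_s2 [NeZero m] (S : Finset (ZMod m)) (x y : ℤ) (h : x < y) (hy : In S y)
    (hn : ∀ z, x < z → z < y → ¬ In S z) : nextIn S (x : ZMod m) = (y : ZMod m) := by
  have h1 := distTo_eq S x y h hy hn
  unfold nextIn
  have h2 : ((distTo S (x : ZMod m) : ℤ) : ZMod m) = ((y - x : ℤ) : ZMod m) := by rw [h1]
  rw [Int.cast_natCast] at h2
  rw [h2]; simp

theorem prevIn_eq_s2 [NeZero m] (S : Finset (ZMod m)) (x y : ℤ) (h : y < x) (hy : In S y)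
    (hn : ∀ z, y < z → z < x → ¬ In S z) : prevIn S (x : ZMod m) = (y : ZMod m) := by
  classical
  have hm : (0 : ℤ) < m := by exact_mod_cast Nat.pos_of_ne_zero (NeZero.ne m)
  have hle : x ≤ y + m := by
    by_contra hc
    exact hn (y + m) (by omega) (by omega) ((In_add_m S y).2 hy)
  have hmem : (x : ZMod m) - ((x - y).toNat : ZMod m) ∈ S := by
    have e : ((x - ((x - y).toNat : ℤ) : ℤ) : ZMod m) ∈ S := by
      rw [show x - ((x - y).toNat : ℤ) = y by omega]; exact hy
    rwa [Int.cast_sub, Int.cast_natCast] at e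
  have hex : ∃ k : ℕ, 0 < k ∧ k ≤ m ∧ (x : ZMod m) - (k : ZMod m) ∈ S :=
    ⟨(x - y).toNat, by omega, by omega, hmem⟩
  have hd : distFrom S (x : ZMod m) = Nat.find hex := by
    unfold distFrom; rw [dif_pos hex]
  have hf : Nat.find hex = (x - y).toNat := by
    rw [Nat.find_eq_iff]
    refine ⟨⟨by omega, by omega, hmem⟩, ?_⟩
    rintro k hk ⟨h1, h2, h3⟩
    refine hn (x - k) (by omega) (by omega) ?_
    unfold In; simpa using h3
  unfold prevIn
  rw [hd, hf]
  have : ((((x - y).toNat : ℕ) : ℤ) : ZMod m) = ((x - y : ℤ) : ZMod m) := by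
    rw [Int.toNat_of_nonneg (by omega)]
  rw [Int.cast_natCast] at this
  rw [this]; simp

/-- switches going to the sign `s` -/
noncomputable def Sw (T : GLStar m) (s : ℤˣ) : Finset (ZMod m) :=
  T.labels.filter fun i => T.omega (prevIn T.labels i) = -s ∧ T.omega i = s

theorem Acal_eq (T : GLStar m) : Acal T = Sw T 1 := rfl
theorem Ccal_eq (T : GLStar m) : Ccal T = Sw T (-1) := by
  unfold Ccal Sw; simp

theorem In_Sw (T : GLStar m) (s : ℤˣ) (x : ℤ) : In (Sw T s) x ↔
    In T.labels x ∧ T.omega (prevIn T.labels (x : ZMod m)) = -s ∧ T.omega (x : ZMod m) = s := by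
  unfold In Sw; simp

theorem units_ne (a s : ℤˣ) (h : a ≠ -s) : a = s := by
  rcases Int.units_eq_one_or a with rfl | rfl <;> rcases Int.units_eq_one_or s with rfl | rfl <;>
    simp_all

theorem units_neg_ne (s : ℤˣ) : s ≠ -s := by
  rcases Int.units_eq_one_or s with rfl | rfl <;> decide

theorem omega_const [NeZero m] (T : GLStar m) (s : ℤˣ) (a : ℤ) (ha : In T.labels a)
    (hs : T.omega (a : ZMod m) = s) (n : ℕ) : ∀ z, a ≤ z → z ≤ a + n → In T.labels z →
    (∀ w, a < w → w ≤ z → ¬ In (Sw T (-s)) w) → T.omega (z : ZMod m) = s := by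
  induction n with
  | zero => intro z h1 h2 _ _; rw [show z = a by omega]; exact hs
  | succ n ih =>
    intro z h1 h2 hz hw
    rcases eq_or_lt_of_le h1 with rfl | h
    · exact hs
    obtain ⟨w, w1, _, w3, w4⟩ := In_exists_prev T.labels a z ha
    have haw : a ≤ w := by
      by_contra hc
      exact w4 a (by omega) h ha
    have hws := ih w haw (by push_cast at h2; omega) w3 (fun v v1 v2 => hw v v1 (by omega))
    have := hw z h le_rfl
    rw [In_Sw, prevIn_eq_s2 T.labels z w w1 w3 w4] at this
    apply units_ne
    intro hc
    exact this ⟨hz, by rw [hws, neg_neg], hc⟩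

theorem omega_const' [NeZero m] (T : GLStar m) (s : ℤˣ) (a : ℤ) (ha : In T.labels a)
    (hs : T.omega (a : ZMod m) = s) (z : ℤ) (h1 : a ≤ z) (hz : In T.labels z)
    (hw : ∀ w, a < w → w ≤ z → ¬ In (Sw T (-s)) w) : T.omega (z : ZMod m) = s :=
  omega_const T s a ha hs (z - a).toNat z h1 (by omega) hz hw

/-- starting with orientation `s`, no `s`-switch can follow without a `-s`-switch before. -/
theorem exists_between [NeZero m] (T : GLStar m) (s : ℤˣ) (a b : ℤ) (hab : a < b)
    (ha : In T.labels a) (hs : T.omega (a : ZMod m) = s) (hb : In (Sw T s) b) :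
    ∃ c, a < c ∧ c < b ∧ In (Sw T (-s)) c := by
  by_contra hc
  push Not at hc
  obtain ⟨w, w1, _, w3, w4⟩ := In_exists_prev T.labels a b ha
  have haw : a ≤ w := by
    by_contra hc
    exact w4 a (by omega) hab ha
  have h1 := omega_const' T s a ha hs w haw w3 (fun v v1 v2 => hc v v1 (by omega))
  rw [In_Sw, prevIn_eq_s2 T.labels b w w1 w3 w4, h1] at hb
  exact units_neg_ne s hb.2.1

theorem alt_AA [NeZero m] (T : GLStar m) (a b : ℤ) (hab : a < b)
    (ha : In (Acal T) a) (hb : In (Acal T) b) : ∃ c, a < c ∧ c < b ∧ In (Ccal T) c := by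
  rw [Ccal_eq]; rw [Acal_eq] at *
  have h := (In_Sw _ _ _).1 ha
  exact exists_between T 1 a b hab h.1 h.2.2 hb

theorem alt_CC [NeZero m] (T : GLStar m) (a b : ℤ) (hab : a < b)
    (ha : In (Ccal T) a) (hb : In (Ccal T) b) : ∃ c, a < c ∧ c < b ∧ In (Acal T) c := by
  rw [Acal_eq]; rw [Ccal_eq] at *
  have h := (In_Sw _ _ _).1 ha
  have := exists_between T (-1) a b hab h.1 h.2.2 hb
  simpa using this

theorem AC_disj (T : GLStar m) (a : ℤ) (ha : In (Acal T) a) (hb : In (Ccal T) a) : False := by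
  rw [Acal_eq, In_Sw] at ha
  rw [Ccal_eq, In_Sw] at hb
  have := ha.2.2.symm.trans hb.2.2
  exact absurd this (by decide)

theorem In_union [DecidableEq (ZMod m)] (S L : Finset (ZMod m)) (x : ℤ) :
    In (S ∪ L) x ↔ In S x ∨ In L x := by
  unfold In; simp

theorem right_lemma [NeZero m] (T : GLStar m) (L : Finset (ZMod m)) (x y : ℤ)
    (hx : In (Ccal T) x) (hxy : x < y) (hy : In (Acal T) y)
    (hL : ∀ z, x < z → z ≤ y → ¬ In L z) (hA : ∀ z, x < z → z < y → ¬ In (Acal T) z) :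
    nextIn (Acal T) (x : ZMod m) = (y : ZMod m) ∧ 0 < distTo (Acal T) (x : ZMod m) ∧
      distTo (Acal T) (x : ZMod m) < distTo (Ccal T ∪ L) (x : ZMod m) := by
  obtain ⟨u, u1, _, u3, u4⟩ := In_exists_next (Ccal T ∪ L) x x ((In_union _ _ _).2 (Or.inl hx))
  have e1 := distTo_eq _ x y hxy hy hA
  have e2 := distTo_eq _ x u u1 u3 u4
  refine ⟨nextIn_eq_s2 _ x y hxy hy hA, by omega, ?_⟩
  suffices y < u by omega
  by_contra hc
  rcases (In_union _ _ _).1 u3 with h | h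
  · rcases eq_or_lt_of_le (not_lt.1 hc) with rfl | h'
    · exact AC_disj T _ hy h
    · obtain ⟨c, c1, c2, c3⟩ := alt_CC T x u u1 hx h
      exact hA c c1 (by omega) c3
  · exact hL u u1 (by omega) h

theorem left_lemma [NeZero m] (T : GLStar m) (L : Finset (ZMod m)) (x y : ℤ)
    (hx : In (Ccal T) x) (hxy : y < x) (hy : In (Acal T) y)
    (hL : ∀ z, y ≤ z → z < x → ¬ In L z) (hA : ∀ z, y < z → z < x → ¬ In (Acal T) z) :
    ∃ b : ℤ, prevIn (Ccal T ∪ L) (x : ZMod m) = (b : ZMod m) ∧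
      nextIn (Acal T) (b : ZMod m) = (y : ZMod m) ∧ 0 < distTo (Acal T) (b : ZMod m) ∧
      distTo (Acal T) (b : ZMod m) < distTo (Ccal T ∪ L) (b : ZMod m) := by
  have hxU := (In_union (Ccal T) L x).2 (Or.inl hx)
  obtain ⟨b, b1, _, b3, b4⟩ := In_exists_prev (Ccal T ∪ L) x x hxU
  have hby : b < y := by
    by_contra hc
    rcases (In_union _ _ _).1 b3 with h | h
    · rcases eq_or_lt_of_le (not_lt.1 hc) with rfl | h'
      · exact AC_disj T _ hy h
      · obtain ⟨c, c1, c2, c3⟩ := alt_CC T b x b1 h hx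
        exact hA c (by omega) (by omega) c3
    · exact hL b (by omega) b1 h
  have hA' : ∀ z, b < z → z < y → ¬ In (Acal T) z := by
    intro z z1 z2 hz
    obtain ⟨c, c1, c2, c3⟩ := alt_AA T z y z2 hz hy
    exact b4 c (by omega) (by omega) ((In_union _ _ _).2 (Or.inl c3))
  have e1 := distTo_eq _ b y hby hy hA'
  have e2 := distTo_eq _ b x b1 hxU b4
  exact ⟨b, prevIn_eq_s2 _ x b b1 b3 b4, nextIn_eq_s2 _ b y hby hy hA', by omega, by omega⟩

theorem right_inv [NeZero m] (T : GLStar m) (L : Finset (ZMod m)) (ε : ℤˣ) (x : ℤ)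
    (hx : In (Ccal T) x) (h : (dRel L ε T).omega (x : ZMod m) = 1) :
    ∃ y, x < y ∧ In (Acal T) y ∧ ∀ z, x < z → z ≤ y → ¬ In L z := by
  have hxU := (In_union (Ccal T) L x).2 (Or.inl hx)
  obtain ⟨u, u1, _, u3, u4⟩ := In_exists_next (Ccal T ∪ L) x x hxU
  have e2 := distTo_eq _ x u u1 u3 u4
  by_cases hc : 0 < distTo (Acal T) (x : ZMod m) ∧
      distTo (Acal T) (x : ZMod m) < distTo (Ccal T ∪ L) (x : ZMod m)
  · have hne : ∃ w, In (Acal T) w := by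
      have h1 := hc.1
      unfold distTo at h1
      split_ifs at h1 with h2
      · obtain ⟨k, _, _, hk⟩ := h2
        exact ⟨x + k, by unfold In; simpa using hk⟩
      · omega
    obtain ⟨w, hw⟩ := hne
    obtain ⟨y, y1, _, y3, y4⟩ := In_exists_next (Acal T) w x hw
    have e1 := distTo_eq _ x y y1 y3 y4
    refine ⟨y, y1, y3, fun z z1 z2 hz => u4 z z1 (by omega) ((In_union _ _ _).2 (Or.inr hz))⟩
  · exfalso
    have : (dRel L ε T).omega (x : ZMod m) = T.omega (x : ZMod m) := if_neg hc
    rw [this] at h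
    rw [Ccal_eq, In_Sw] at hx
    exact absurd (h.symm.trans hx.2.2) (by decide)

theorem left_inv [NeZero m] (T : GLStar m) (L : Finset (ZMod m)) (hLab : L ⊆ T.labels)
    (ε : ℤˣ) (x : ℤ) (hx : In (Ccal T) x)
    (h : (dRel L ε T).omega (prevIn (Ccal T ∪ L) (x : ZMod m)) = -1) :
    ∃ y, y < x ∧ In (Acal T) y ∧ ∀ z, y ≤ z → z < x → ¬ In L z := by
  have hxU := (In_union (Ccal T) L x).2 (Or.inl hx)
  obtain ⟨b, b1, _, b3, b4⟩ := In_exists_prev (Ccal T ∪ L) x x hxU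
  have e2 := distTo_eq _ b x b1 hxU b4
  rw [prevIn_eq_s2 _ x b b1 b3 b4] at h
  by_contra hcon
  have hnoA : ∀ y, b < y → y < x → ¬ In (Acal T) y := by
    intro y y1 y2 hy
    exact hcon ⟨y, y2, hy, fun z z1 z2 hz => b4 z (by omega) z2 ((In_union _ _ _).2 (Or.inr hz))⟩
  have hc : ¬ (0 < distTo (Acal T) (b : ZMod m) ∧
      distTo (Acal T) (b : ZMod m) < distTo (Ccal T ∪ L) (b : ZMod m)) := by
    rintro ⟨h1, h2⟩
    have hne : ∃ w, In (Acal T) w := by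
      unfold distTo at h1
      split_ifs at h1 with h2
      · obtain ⟨k, _, _, hk⟩ := h2
        exact ⟨b + k, by unfold In; simpa using hk⟩
      · omega
    obtain ⟨w, hw⟩ := hne
    obtain ⟨y, y1, _, y3, y4⟩ := In_exists_next (Acal T) w b hw
    have e1 := distTo_eq _ b y y1 y3 y4
    exact hnoA y y1 (by omega) y3
  have hb : T.omega (b : ZMod m) = -1 := by
    rw [← h]; exact (if_neg hc).symm
  have hbl : In T.labels b := by
    rcases (In_union _ _ _).1 b3 with h | h
    · rw [Ccal_eq, In_Sw] at h; exact h.1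
    · exact hLab h
  rw [Ccal_eq] at hx
  obtain ⟨c, c1, c2, c3⟩ := exists_between T (-1) b x b1 hbl hb hx
  rw [neg_neg] at c3
  exact hnoA c c1 c2 c3

/-- The invariant. -/
def Inv (L : Finset (ZMod m)) (T R : GLStar m) : Prop :=
  ∀ a k : ℤ, a ≤ k → In (Acal R) a → In (Acal R) k → (∀ z, a ≤ z → z ≤ k → ¬ In L z) →
    ∀ z, a ≤ z → z ≤ k → (In (Acal R) z ↔ In (Acal T) z) ∧ (In (Ccal R) z ↔ In (Ccal T) z)

theorem dSigned_labels (b : Bool) (T : GLStar m) : (dSigned b T).labels = Ccal T := by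
  cases b <;> rfl

theorem dSigned_chi (b : Bool) (T : GLStar m) : (dSigned b T).chi = T.chi := by
  cases b <;> rfl

theorem dSigned_omega (b : Bool) (T : GLStar m) (i : ZMod m) :
    (dSigned b T).omega i = (if b then 1 else -1) * T.chi (nextIn (Acal T) i) := by
  cases b <;> simp [dSigned, dMinus, dPlus, conj]

theorem Inv_step [NeZero m] (L : Finset (ZMod m)) (T R : GLStar m) (hchi : R.chi = T.chi)
    (hLab : L ⊆ R.labels) (b : Bool) (h : Inv L T R) :
    Inv L (dSigned b T) (dRelSigned L b R) := by
  intro a k hak ha hk hL x hx1 hx2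
  have key : ∀ a, In (Acal (dRelSigned L b R)) a → ¬ In L a → In (Ccal R) a ∧
      (∃ y, a < y ∧ In (Acal R) y ∧ ∀ z, a < z → z ≤ y → ¬ In L z) ∧
      (∃ y, y < a ∧ In (Acal R) y ∧ ∀ z, y ≤ z → z < a → ¬ In L z) := by
    intro a ha haL
    rw [Acal_eq, In_Sw] at ha
    obtain ⟨h1, h2, h3⟩ := ha
    have hC : In (Ccal R) a := ((In_union _ _ _).1 h1).resolve_right haL
    exact ⟨hC, right_inv R L _ a hC h3, left_inv R L hLab _ a hC h2⟩
  obtain ⟨-, -, p, p1, p2, p3⟩ := key a ha (hL a le_rfl hak)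
  obtain ⟨-, ⟨q, q1, q2, q3⟩, -⟩ := key k hk (hL k hak le_rfl)
  have hLpq : ∀ z, p ≤ z → z ≤ q → ¬ In L z := by
    intro z z1 z2
    by_cases c1 : z < a
    · exact p3 z z1 c1
    by_cases c2 : z ≤ k
    · exact hL z (by omega) c2
    exact q3 z (by omega) z2
  have hI := h p q (by omega) p2 q2 hLpq
  have hlabR : In (dRelSigned L b R).labels x ↔ In (Ccal R) x := by
    refine (In_union _ _ _).trans ⟨fun h => h.resolve_right (hL x hx1 hx2), Or.inl⟩
  have hlabT : In (dSigned b T).labels x ↔ In (Ccal R) x := by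
    rw [dSigned_labels, (hI x (by omega) (by omega)).2]
  rw [Acal_eq, Acal_eq, Ccal_eq, Ccal_eq, In_Sw, In_Sw, In_Sw, In_Sw, hlabR, hlabT]
  by_cases hxC : In (Ccal R) x
  swap
  · simp [hxC]
  have hxT : In (Ccal T) x := (hI x (by omega) (by omega)).2.1 hxC
  obtain ⟨y, y1, _, y3, y4⟩ := In_exists_next (Acal R) q x q2
  obtain ⟨v, v1, _, v3, v4⟩ := In_exists_prev (Acal R) p x p2
  have hyq : y ≤ q := by
    by_contra hc; exact y4 q (by omega) (by omega) q2
  have hpv : p ≤ v := by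
    by_contra hc; exact v4 p (by omega) (by omega) p2
  obtain ⟨r1, r2, r3⟩ := right_lemma R L x y hxC y1 y3
    (fun z z1 z2 => hLpq z (by omega) (by omega)) y4
  obtain ⟨t1, -, -⟩ := right_lemma T ∅ x y hxT y1 ((hI y (by omega) (by omega)).1.1 y3)
    (fun z z1 z2 => by simp [In])
    (fun z z1 z2 hz => y4 z z1 z2 ((hI z (by omega) (by omega)).1.2 hz))
  obtain ⟨c, l0, l1, l2, l3⟩ := left_lemma R L x v hxC v1 v3
    (fun z z1 z2 => hLpq z (by omega) (by omega)) v4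
  obtain ⟨d, s0, s1, -, -⟩ := left_lemma T ∅ x v hxT v1 ((hI v (by omega) (by omega)).1.1 v3)
    (fun z z1 z2 => by simp [In])
    (fun z z1 z2 hz => v4 z z1 z2 ((hI z (by omega) (by omega)).1.2 hz))
  rw [Finset.union_empty] at s0
  have E1 : (dRelSigned L b R).omega (x : ZMod m) = (dSigned b T).omega (x : ZMod m) := by
    rw [dSigned_omega, t1, ← hchi, ← r1]
    exact if_pos ⟨r2, r3⟩
  have E2 : (dRelSigned L b R).omega (prevIn (dRelSigned L b R).labels (x : ZMod m)) =
      (dSigned b T).omega (prevIn (dSigned b T).labels (x : ZMod m)) := by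
    rw [dSigned_labels, s0, dSigned_omega, s1, ← hchi, ← l1]
    change (dRelSigned L b R).omega (prevIn (Ccal R ∪ L) (x : ZMod m)) = _
    rw [l0]
    exact if_pos ⟨l2, l3⟩
  rw [E1, E2]
  exact ⟨Iff.rfl, Iff.rfl⟩

end GLStar

open GLStar in
/-- let `T` be a nontrivial star on the full label set
`ZMod m` with a sequence of coherence `(T_1, …, T_n)` (so `T_1 ∈ {T, conj T}`,
each `T_i = d^{ε_i} T_{i-1}` for `2 ≤ i ≤ n`, each `T_i` is nontrivial, and
`T_n` is coherent).  Let `L₀ ⊆ ZMod m` and let `(R_1, …, R_n)` be the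
`L₀`-sequence with `R_1 = T_1` and `R_i = d₀^{ε_i} R_{i-1}` (the sign of each
relative derivative matching the corresponding derivative in the sequence of
coherence), each `R_i` nontrivial.  Then all elements of
`Ã(R_n) = A(R_n) \ L₀` have the same character. -/
theorem chi_constant_on_Atilde_of_L0_sequence
    {m : ℕ} [NeZero m] (T : GLStar m) (hfull : T.labels = Finset.univ)
    (hT : T.IsNontrivial) (L₀ : Finset (ZMod m))
    (n : ℕ) (hn : 1 ≤ n) (ε : ℕ → Bool) (Ts Rs : ℕ → GLStar m)
    (hT1 : Ts 1 = T ∨ Ts 1 = GLStar.conj T)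
    (hTstep : ∀ i, 2 ≤ i → i ≤ n → Ts i = dSigned (ε i) (Ts (i - 1)))
    (hTnontriv : ∀ i, 1 ≤ i → i ≤ n → (Ts i).IsNontrivial)
    (hTcoh : (Ts n).IsCoherent)
    (hR1 : Rs 1 = Ts 1)
    (hRstep : ∀ i, 2 ≤ i → i ≤ n → Rs i = dRelSigned L₀ (ε i) (Rs (i - 1)))
    (hRnontriv : ∀ i, 1 ≤ i → i ≤ n → (Rs i).IsNontrivial) :
    ∀ a ∈ Acal (Rs n) \ L₀, ∀ b ∈ Acal (Rs n) \ L₀,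
      (Rs n).chi a = (Rs n).chi b := by
  have main : ∀ i, 1 ≤ i → i ≤ n →
      Inv L₀ (Ts i) (Rs i) ∧ (Rs i).chi = (Ts i).chi ∧ L₀ ⊆ (Rs i).labels := by
    intro i hi
    induction i, hi using Nat.le_induction with
    | base =>
      intro _
      rw [hR1]
      refine ⟨fun _ _ _ _ _ _ _ _ _ => ⟨Iff.rfl, Iff.rfl⟩, rfl, ?_⟩
      have : (Ts 1).labels = Finset.univ := by
        rcases hT1 with h | h <;> rw [h]
        · exact hfull
        · exact hfull
      rw [this]; exact Finset.subset_univ _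
    | succ i hi ih =>
      intro hin
      obtain ⟨h1, h2, h3⟩ := ih (by omega)
      rw [hRstep (i + 1) (by omega) hin, hTstep (i + 1) (by omega) hin]
      simp only [Nat.add_sub_cancel]
      refine ⟨Inv_step L₀ _ _ h2 h3 _ h1, ?_, ?_⟩
      · rw [dSigned_chi]; exact h2
      · exact Finset.subset_union_right
  obtain ⟨h1, h2, -⟩ := main n hn le_rfl
  have mem : ∀ a ∈ Acal (Rs n) \ L₀, a ∈ Acal (Ts n) := by
    intro a ha
    rw [Finset.mem_sdiff] at ha
    obtain ⟨x, rfl⟩ := ZMod.intCast_surjective a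
    refine (h1 x x le_rfl ha.1 ha.1 ?_ x le_rfl le_rfl).1.1 ha.1
    intro z z1 z2
    rw [show z = x by omega]; exact ha.2
  intro a ha b hb
  rw [h2]
  exact hTcoh.1 a (mem a ha) b (mem b hb)
end

section
/- Let (D, σ, α) be a connected spherical combinatorial map in which every vertex has even degree. Then there is a function c : D → {black, white} that is constant on each face (each σ∘α-orbit) and satisfies c(d) ≠ c(α(d)) for every dart d ∈ D; that is, the faces can be two-colored so that each edge has each color on exactly one side. (This is the combinatorial-map formulation of the paper's Proposition for graphs embedded in the 2-sphere.) -/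
/-!
Combinatorial maps: a finite nonempty dart set `D`, a fixed-point-free
involution `α` (edges = `α`-orbits), and a permutation `σ` (vertices =
`σ`-orbits); faces are the orbits of `σ ∘ α` (i.e. of the permutation
`σ * α`).  The map is connected if `⟨σ, α⟩` acts transitively on darts, and
spherical if `V - E + F = 2`.
-/

/-- The orbit of a dart `d` under a permutation `g`, as a `Finset`. -/
noncomputable def permOrbit {D : Type} [Fintype D] (g : Equiv.Perm D) (d : D) :
    Finset D :=
  open Classical in Finset.univ.filter fun x => g.SameCycle d x

/-- The number of orbits of a permutation `g` of a finite type. -/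
noncomputable def numOrbits {D : Type} [Fintype D] (g : Equiv.Perm D) : ℕ :=
  open Classical in (Finset.univ.image fun d => permOrbit g d).card

namespace FTC

abbrev Q {D : Type} (g : Equiv.Perm D) : Type := Quotient (Equiv.Perm.SameCycle.setoid g)

def mk {D : Type} (g : Equiv.Perm D) (d : D) : Q g := Quotient.mk _ d

theorem mk_eq {D : Type} (g : Equiv.Perm D) (d e : D) : mk g d = mk g e ↔ g.SameCycle d e :=
  Quotient.eq (r := Equiv.Perm.SameCycle.setoid g)

theorem mk_surj {D : Type} (g : Equiv.Perm D) (q : Q g) : ∃ d, mk g d = q :=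
  Quotient.exists_rep q

theorem mk_apply {D : Type} (g : Equiv.Perm D) (d : D) : mk g (g d) = mk g d := by
  rw [mk_eq]
  exact (Equiv.Perm.sameCycle_apply_left).2 (Equiv.Perm.SameCycle.refl _ _)

noncomputable instance {D : Type} [Fintype D] (g : Equiv.Perm D) : Fintype (Q g) :=
  Fintype.ofFinite _

theorem mem_permOrbit {D : Type} [Fintype D] (g : Equiv.Perm D) (d x : D) :
    x ∈ permOrbit g d ↔ g.SameCycle d x := by
  classical
  simp [permOrbit]

theorem card_Q {D : Type} [Fintype D] (g : Equiv.Perm D) : Fintype.card (Q g) = numOrbits g := by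
  classical
  have key : ∀ d e, permOrbit g d = permOrbit g e ↔ g.SameCycle d e := by
    intro d e
    constructor
    · intro h
      have : e ∈ permOrbit g d := by
        rw [h, mem_permOrbit]
      exact (mem_permOrbit g d e).1 this
    · intro h
      ext x
      rw [mem_permOrbit, mem_permOrbit]
      exact ⟨fun k => h.symm.trans k, fun k => h.trans k⟩
  let F : Q g → Finset D := Quotient.lift (permOrbit g) (fun a b h => (key a b).2 h)
  have hF : ∀ d, F (mk g d) = permOrbit g d := fun d => rfl
  have hinj : Function.Injective F := by
    intro a b h
    obtain ⟨d, rfl⟩ := mk_surj g a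
    obtain ⟨e, rfl⟩ := mk_surj g b
    rw [hF, hF] at h
    exact (mk_eq g d e).2 ((key d e).1 h)
  have : numOrbits g = (Finset.univ.image F).card := by
    unfold numOrbits
    congr 1
    ext s
    simp only [Finset.mem_image, Finset.mem_univ, true_and]
    constructor
    · rintro ⟨d, rfl⟩
      exact ⟨mk g d, rfl⟩
    · rintro ⟨q, rfl⟩
      obtain ⟨d, rfl⟩ := mk_surj g q
      exact ⟨d, rfl⟩
  rw [this, Finset.card_image_of_injective _ hinj, Finset.card_univ]

theorem const_of_inv {D : Type} {β : Type} (σ α : Equiv.Perm D)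
    (hconn : ∀ d d' : D,
      ∃ g ∈ Subgroup.closure ({σ, α} : Set (Equiv.Perm D)), g d = d')
    (F : D → β) (h1 : ∀ d, F (σ d) = F d) (h2 : ∀ d, F (α d) = F d) (d e : D) : F d = F e := by
  obtain ⟨g, hg, rfl⟩ := hconn d e
  have : ∀ d, F (g d) = F d := by
    induction hg using Subgroup.closure_induction with
    | mem x hx =>
      rcases hx with rfl | hx
      · exact h1
      · rw [Set.mem_singleton_iff] at hx
        subst hx
        exact h2
    | one => intro d; rfl
    | mul x y _ _ hx hy => intro d; rw [Equiv.Perm.mul_apply, hx, hy]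
    | inv x _ hx => intro d; rw [← hx (x⁻¹ d), ← Equiv.Perm.mul_apply, mul_inv_cancel, Equiv.Perm.one_apply]
  exact (this d).symm

theorem inv_of_sameCycle {D : Type} [Finite D] {β : Type} (g : Equiv.Perm D) (F : D → β)
    (h : ∀ d, F (g d) = F d) {d e : D} (hs : g.SameCycle d e) : F d = F e := by
  obtain ⟨n, rfl⟩ := hs.exists_nat_pow_eq
  induction n with
  | zero => rfl
  | succ n ih =>
    rw [pow_succ', Equiv.Perm.mul_apply, h]
    exact ih ⟨n, by simp⟩

/-- pairing between functions on edges and functions on vertices -/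
noncomputable def T {D : Type} [Fintype D] (σ α : Equiv.Perm D) :
    (Q α → ZMod 2) →ₗ[ZMod 2] Module.Dual (ZMod 2) (Q σ → ZMod 2) :=
  LinearMap.mk₂ (ZMod 2) (fun h f => ∑ d, h (mk α d) * f (mk σ d))
    (by intros; simp [add_mul, Finset.sum_add_distrib])
    (by intros; simp [Finset.mul_sum, mul_assoc])
    (by intros; simp [mul_add, Finset.sum_add_distrib])
    (by intros; simp [Finset.mul_sum, mul_left_comm])

theorem T_apply {D : Type} [Fintype D] (σ α : Equiv.Perm D) (h : Q α → ZMod 2)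
    (f : Q σ → ZMod 2) : T σ α h f = ∑ d, h (mk α d) * f (mk σ d) := rfl

noncomputable def δ {D : Type} [Fintype D] (φ α : Equiv.Perm D)
    (hinv : ∀ d, α (α d) = d) :
    (Q φ → ZMod 2) →ₗ[ZMod 2] (Q α → ZMod 2) where
  toFun c := Quotient.lift (fun d => c (mk φ d) + c (mk φ (α d))) (fun a b h =>
    inv_of_sameCycle α (fun d => c (mk φ d) + c (mk φ (α d)))
      (fun d => by simp only [hinv]; rw [add_comm]) h)
  map_add' c c' := by
    funext q
    obtain ⟨d, rfl⟩ := mk_surj α q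
    show (c + c') _ + (c + c') _ = (c _ + c _) + (c' _ + c' _)
    simp only [Pi.add_apply]; ring
  map_smul' r c := by
    funext q
    obtain ⟨d, rfl⟩ := mk_surj α q
    show (r • c) _ + (r • c) _ = r * (c _ + c _)
    simp only [Pi.smul_apply, smul_eq_mul]; ring

theorem δ_apply {D : Type} [Fintype D] (φ α : Equiv.Perm D)
    (hinv : ∀ d, α (α d) = d) (c : Q φ → ZMod 2) (d : D) :
    δ φ α hinv c (mk α d) = c (mk φ d) + c (mk φ (α d)) := rfl

theorem z2 {a b : ZMod 2} (h : a + b = 0) : b = a := by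
  revert a b; decide

theorem finrank_le_one_of_const {D : Type} [Fintype D] [Nonempty D] (g : Equiv.Perm D)
    (S : Submodule (ZMod 2) (Q g → ZMod 2))
    (h : ∀ f ∈ S, ∀ d e, f (mk g d) = f (mk g e)) : Module.finrank (ZMod 2) S ≤ 1 := by
  have hle : S ≤ Submodule.span (ZMod 2) {(fun _ => 1 : Q g → ZMod 2)} := by
    intro f hf
    rw [Submodule.mem_span_singleton]
    refine ⟨f (mk g (Classical.arbitrary D)), ?_⟩
    funext q
    obtain ⟨d, rfl⟩ := mk_surj g q
    simp [h f hf d (Classical.arbitrary D)]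
  refine (Submodule.finrank_mono hle).trans ?_
  simpa using finrank_span_le_card (R := ZMod 2) {(fun _ => 1 : Q g → ZMod 2)}

end FTC

open FTC in
/-- in a connected spherical combinatorial map `(D, σ, α)`
all of whose vertices have even degree, the faces (the orbits of `σ ∘ α`,
i.e. of `σ * α`) can be two-colored so that each edge `{d, α d}` has each
color on exactly one side. -/
theorem exists_face_two_coloring_of_even_degrees
    {D : Type} [Fintype D] [DecidableEq D] [Nonempty D]
    (σ α : Equiv.Perm D)
    (hinv : ∀ d, α (α d) = d) (hfpf : ∀ d, α d ≠ d)
    (hconn : ∀ d d' : D,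
      ∃ g ∈ Subgroup.closure ({σ, α} : Set (Equiv.Perm D)), g d = d')
    (hsph : (numOrbits σ : ℤ) - numOrbits α + numOrbits (σ * α) = 2)
    (heven : ∀ d : D, Even (permOrbit σ d).card) :
    ∃ c : D → Bool,
      (∀ d e : D, (σ * α).SameCycle d e → c d = c e) ∧
      (∀ d : D, c d ≠ c (α d)) := by
  classical
  have hφ : ∀ d, mk (σ * α) (σ d) = mk (σ * α) (α d) := by
    intro d
    have := mk_apply (σ * α) (α d)
    rwa [Equiv.Perm.mul_apply, hinv] at this
  -- kernel of δ
  have hk : Module.finrank (ZMod 2) (LinearMap.ker (δ (σ * α) α hinv)) ≤ 1 := by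
    apply finrank_le_one_of_const
    intro c hc
    have hα : ∀ d, c (mk (σ * α) (α d)) = c (mk (σ * α) d) := by
      intro d
      apply z2
      rw [← δ_apply (σ * α) α hinv c d, LinearMap.mem_ker.1 hc]; rfl
    apply const_of_inv σ α hconn (fun d => c (mk (σ * α) d)) _ hα
    intro d
    simp only [hφ, hα]
  have hk2 : Module.finrank (ZMod 2) (LinearMap.range (T σ α)).dualCoannihilator ≤ 1 := by
    apply finrank_le_one_of_const
    intro f hf
    rw [Submodule.mem_dualCoannihilator] at hf
    apply const_of_inv σ α hconn (fun d => f (mk σ d))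
    · intro d; simp only [mk_apply]
    · intro d
      have := hf _ ⟨Pi.single (mk α d) 1, rfl⟩
      rw [T_apply] at this
      have hfil : (Finset.univ.filter fun x => mk α x = mk α d) = {d, α d} := by
        ext x
        simp only [Finset.mem_filter, Finset.mem_univ, true_and, Finset.mem_insert,
          Finset.mem_singleton]
        constructor
        · intro hx
          have hx := (mk_eq _ _ _).1 hx.symm
          obtain ⟨n, hn⟩ := hx.exists_nat_pow_eq
          rw [← hn]
          clear hn hx this
          induction n with
          | zero => left; rfl
          | succ n ih =>
            rw [pow_succ', Equiv.Perm.mul_apply]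
            rcases ih with ih | ih <;> rw [ih]
            · right; rfl
            · left; exact hinv d
        · rintro (rfl | rfl)
          · rfl
          · exact mk_apply _ _
      simp only [Pi.single_apply, ite_mul, one_mul, zero_mul] at this
      rw [← Finset.sum_filter, hfil, Finset.sum_pair (hfpf d).symm] at this
      exact z2 this
  have e1 := Subspace.finrank_add_finrank_dualCoannihilator_eq (LinearMap.range (T σ α))
  have e2 := LinearMap.finrank_range_add_finrank_ker (T σ α)
  have e3 := LinearMap.finrank_range_add_finrank_ker (δ (σ * α) α hinv)
  rw [Module.finrank_fintype_fun_eq_card, card_Q] at e1 e2 e3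
  have hle : LinearMap.range (δ (σ * α) α hinv) ≤ LinearMap.ker (T σ α) := by
    rintro _ ⟨c, rfl⟩
    rw [LinearMap.mem_ker]
    refine LinearMap.ext fun f => ?_
    rw [T_apply]
    simp only [δ_apply, add_mul, Finset.sum_add_distrib, LinearMap.zero_apply]
    have : ∑ d, c (mk (σ * α) (α d)) * f (mk σ d) = ∑ d, c (mk (σ * α) d) * f (mk σ d) := by
      rw [← Equiv.sum_comp σ (fun d => c (mk (σ * α) d) * f (mk σ d))]
      simp only [hφ, mk_apply]
    rw [this]
    exact CharTwo.add_self_eq_zero _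
  have heq := Submodule.eq_of_le_of_finrank_le hle (by omega)
  have hone : (fun _ => 1 : Q α → ZMod 2) ∈ LinearMap.ker (T σ α) := by
    rw [LinearMap.mem_ker]
    refine LinearMap.ext fun f => ?_
    rw [T_apply]
    simp only [one_mul, LinearMap.zero_apply]
    rw [← Finset.sum_fiberwise (s := Finset.univ) (g := mk σ)]
    apply Finset.sum_eq_zero
    intro q _
    obtain ⟨d, rfl⟩ := mk_surj σ q
    have : (Finset.univ.filter fun x => mk σ x = mk σ d) = permOrbit σ d := by
      ext x
      rw [mem_permOrbit, ← mk_eq]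
      simp [eq_comm]
    rw [this, Finset.sum_congr rfl (g := fun _ => f (mk σ d))]
    · rw [Finset.sum_const, nsmul_eq_mul, (ZMod.natCast_eq_zero_iff_even).2 (heven d), zero_mul]
    · intro x hx
      rw [(mk_eq σ d x).2 ((mem_permOrbit _ _ _).1 hx)]
  rw [← heq] at hone
  obtain ⟨c, hc⟩ := hone
  refine ⟨fun d => decide (c (mk (σ * α) d) = 0), ?_, ?_⟩
  · intro d e h
    simp only [(mk_eq _ _ _).2 h]
  · intro d
    have h := δ_apply (σ * α) α hinv c d
    rw [hc] at h
    show decide (c (mk (σ * α) d) = 0) ≠ decide (c (mk (σ * α) (α d)) = 0)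
    have h : c (mk (σ * α) d) + c (mk (σ * α) (α d)) = 1 := h.symm
    revert h
    generalize c (mk (σ * α) d) = a
    generalize c (mk (σ * α) (α d)) = b
    revert a b
    decide
end

section
/- Let (D, σ, α) be a connected spherical combinatorial map equipped with an orientation O ⊆ D (exactly one dart of each edge lies in O). For a vertex v (a σ-orbit), let s(v) = #{d ∈ v : (d ∈ O) ≠ (σ(d) ∈ O)} and I(v) = 1 − s(v)/2; for a face F (a σ∘α-orbit), let s(F) = #{d ∈ F : (d ∈ O) ≠ ((σ∘α)(d) ∈ O)} and I(F) = 1 − s(F)/2. Then the sum of I(v) over all vertices plus the sum of I(F) over all faces equals 2. (This is the combinatorial-map formulation, for connected graphs in the 2-sphere, of the index identity ∑_{vertices} I(v) + ∑_{faces} I(F) = 2 for directed plane graphs.) -/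
/-- The set of orbits of a permutation `g`, as a `Finset` of `Finset`s. -/
noncomputable def permOrbits {D : Type} [Fintype D] (g : Equiv.Perm D) :
    Finset (Finset D) :=
  open Classical in Finset.univ.image fun d => permOrbit g d

/-- The number of switches of the orientation `O` around an orbit `v` of the
permutation `g`: the number of darts `d ∈ v` with exactly one of `d`, `g d`
in `O`. -/
noncomputable def switchCount {D : Type} [Fintype D] (g : Equiv.Perm D)
    (O : Finset D) (v : Finset D) : ℕ :=
  open Classical in (v.filter fun d => ¬ ((d ∈ O) ↔ g d ∈ O)).card

open Classical in
theorem aux_sum_orbits {D : Type} [Fintype D] (g : Equiv.Perm D) (p : D → Prop) :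
    ∑ v ∈ permOrbits g, (v.filter p).card = (Finset.univ.filter p).card := by
  have key := Finset.card_eq_sum_card_fiberwise (s := Finset.univ.filter p)
    (t := permOrbits g) (f := fun d => permOrbit g d)
    (fun x _ => by simp [permOrbits])
  rw [key]
  refine Finset.sum_congr rfl fun v hv => ?_
  congr 1
  simp only [permOrbits, Finset.mem_image, Finset.mem_univ, true_and] at hv
  obtain ⟨d, rfl⟩ := hv
  ext x
  simp only [Finset.mem_filter, Finset.mem_univ, true_and]
  constructor
  · rintro ⟨h, hp⟩
    refine ⟨hp, ?_⟩
    simp only [permOrbit, Finset.mem_filter, Finset.mem_univ, true_and] at h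
    ext y
    simp only [permOrbit, Finset.mem_filter, Finset.mem_univ, true_and]
    exact ⟨fun k => h.trans k, fun k => h.symm.trans k⟩
  · rintro ⟨hp, h⟩
    refine ⟨?_, hp⟩
    rw [← h]
    simp [permOrbit, Equiv.Perm.SameCycle.refl]

open Classical in
theorem aux_card_alpha {D : Type} [Fintype D] (α : Equiv.Perm D)
    (hinv : ∀ d, α (α d) = d) (hfpf : ∀ d, α d ≠ d) :
    numOrbits α * 2 = Fintype.card D := by
  have h := aux_sum_orbits α (fun _ => True)
  simp only [Finset.filter_true, Finset.card_univ] at h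
  rw [← h, Finset.sum_const_nat (m := 2)]
  · rfl
  · intro v hv
    simp only [permOrbits, Finset.mem_image, Finset.mem_univ, true_and] at hv
    obtain ⟨d, rfl⟩ := hv
    have : permOrbit α d = {d, α d} := by
      ext x
      simp only [permOrbit, Finset.mem_filter, Finset.mem_univ, true_and,
        Finset.mem_insert, Finset.mem_singleton]
      constructor
      · intro hx
        obtain ⟨n, rfl⟩ := hx.exists_nat_pow_eq
        clear hx
        induction n with
        | zero => simp
        | succ n ih =>
          rw [pow_succ', Equiv.Perm.mul_apply]
          rcases ih with ih | ih <;> rw [ih]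
          · exact Or.inr rfl
          · exact Or.inl (hinv d)
      · rintro (rfl | rfl)
        · exact Equiv.Perm.SameCycle.refl _ _
        · exact ⟨1, by simp⟩
    rw [this, Finset.card_pair (hfpf d).symm]

/-- index identity: in a connected spherical combinatorial
map `(D, σ, α)` with an orientation `O` (exactly one dart of each edge lies
in `O`), with `I(v) = 1 - s(v)/2` for each vertex (σ-orbit) `v` and
`I(F) = 1 - s(F)/2` for each face (σ∘α-orbit) `F`, the sum of `I(v)` over all
vertices plus the sum of `I(F)` over all faces equals `2`. -/
theorem sum_vertex_index_add_sum_face_index_eq_two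
    {D : Type} [Fintype D] [DecidableEq D] [Nonempty D]
    (σ α : Equiv.Perm D)
    (hinv : ∀ d, α (α d) = d) (hfpf : ∀ d, α d ≠ d)
    (hconn : ∀ d d' : D,
      ∃ g ∈ Subgroup.closure ({σ, α} : Set (Equiv.Perm D)), g d = d')
    (hsph : (numOrbits σ : ℤ) - numOrbits α + numOrbits (σ * α) = 2)
    (O : Finset D) (hO : ∀ d : D, Xor' (d ∈ O) (α d ∈ O)) :
    (∑ v ∈ permOrbits σ, (1 - (switchCount σ O v : ℚ) / 2)) +
      (∑ F ∈ permOrbits (σ * α), (1 - (switchCount (σ * α) O F : ℚ) / 2)) = 2 := by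
  classical
  have h1 : ∑ v ∈ permOrbits σ, switchCount σ O v
      = (Finset.univ.filter fun d => ¬ ((d ∈ O) ↔ σ d ∈ O)).card := by
    convert aux_sum_orbits σ (fun d => ¬ ((d ∈ O) ↔ σ d ∈ O))
    unfold switchCount
    congr!
  have h2 : ∑ v ∈ permOrbits (σ * α), switchCount (σ * α) O v
      = (Finset.univ.filter fun d => ¬ ((d ∈ O) ↔ (σ * α) d ∈ O)).card := by
    convert aux_sum_orbits (σ * α) (fun d => ¬ ((d ∈ O) ↔ (σ * α) d ∈ O))
    unfold switchCount
    congr!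
  have h3 : (Finset.univ.filter fun d => ¬ ((d ∈ O) ↔ (σ * α) d ∈ O)).card
      = (Finset.univ.filter fun d => ((d ∈ O) ↔ σ d ∈ O)).card := by
    refine Finset.card_bij (fun d _ => α d) ?_ (fun a _ b _ h => α.injective h) ?_
    · intro d hd
      have h := hO d
      have hd' := (Finset.mem_filter.1 hd).2
      rw [Equiv.Perm.mul_apply] at hd'
      refine Finset.mem_filter.2 ⟨Finset.mem_univ _, ?_⟩
      rcases h with h | h <;> tauto
    · intro d hd
      have h := hO d
      have hd' := (Finset.mem_filter.1 hd).2
      refine ⟨α d, Finset.mem_filter.2 ⟨Finset.mem_univ _, ?_⟩, hinv d⟩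
      rw [Equiv.Perm.mul_apply, hinv]
      rcases h with h | h <;> tauto
  have h4 := Finset.card_filter_add_card_filter_not (s := (Finset.univ : Finset D))
    (fun d => ((d ∈ O) ↔ σ d ∈ O))
  have h5 := aux_card_alpha α hinv hfpf
  rw [Finset.card_univ, ← h3, ← h2, ← h1, ← h5] at h4
  have e1 : (permOrbits σ).card = numOrbits σ := rfl
  have e2 : (permOrbits (σ * α)).card = numOrbits (σ * α) := rfl
  simp only [Finset.sum_sub_distrib, ← Finset.sum_div, Finset.sum_const, nsmul_eq_mul,
    mul_one, e1, e2]
  have h4' : (∑ v ∈ permOrbits (σ * α), (switchCount (σ * α) O v : ℚ))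
      + ∑ v ∈ permOrbits σ, (switchCount σ O v : ℚ) = numOrbits α * 2 := by
    exact_mod_cast h4
  have h6 : (numOrbits σ : ℚ) - numOrbits α + numOrbits (σ * α) = 2 := by
    exact_mod_cast hsph
  linarith
end
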